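/- Let G = ⟨a,b_1,…,b_r⟩ be a multi-GGS-group with r ≥ 2. Then ψ₂(G″ ∩ st(2)) contains G′ × ⋯ × G′ (p² factors). -/

import Mathlib

/-!
Automorphisms of the `p`-regular rooted tree, encoded by portraits:
an automorphism is a family of permutations of `Fin p`, one for each vertex
(vertices are finite words over `Fin p`, the root being `[]`).
-/

namespace TreeAut

variable {p : ℕ}

/-- Automorphisms of the `p`-regular rooted tree, given by their portraits. -/
def AutT (p : ℕ) : Type := List (Fin p) → Equiv.Perm (Fin p)

namespace AutT

/-- The action of a tree automorphism on the vertices (finite words over `Fin p`). -/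
def act : AutT p → List (Fin p) → List (Fin p)
  | _, [] => []
  | f, x :: w => f [] x :: act (fun v => f (x :: v)) w

/-- The section of `f` at the level-one vertex `x`; the map
`f ↦ (sections f 0, …, sections f (p-1))` restricted to the first-level
stabilizer is the isomorphism `ψ`. -/
def sections (f : AutT p) : Fin p → AutT p := fun x v => f (x :: v)

instance : One (AutT p) := ⟨fun _ => 1⟩

instance : Mul (AutT p) := ⟨fun f g v => f (act g v) * g v⟩

/-- The action of the inverse automorphism on vertices. -/
def invAct : AutT p → List (Fin p) → List (Fin p)
  | _, [] => []
  | f, x :: w => (f [])⁻¹ x :: invAct (fun v => f (((f [])⁻¹ x) :: v)) w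

instance : Inv (AutT p) := ⟨fun f v => (f (invAct f v))⁻¹⟩

lemma one_apply (v : List (Fin p)) : (1 : AutT p) v = 1 := rfl

lemma mul_apply (f g : AutT p) (v : List (Fin p)) : (f * g) v = f (act g v) * g v := rfl

lemma inv_apply (f : AutT p) (v : List (Fin p)) : f⁻¹ v = (f (invAct f v))⁻¹ := rfl

lemma act_nil (f : AutT p) : act f [] = [] := rfl

lemma act_cons (f : AutT p) (x : Fin p) (w : List (Fin p)) :
    act f (x :: w) = f [] x :: act (sections f x) w := rfl

lemma sections_mul (f g : AutT p) (x : Fin p) :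
    sections (f * g) x = sections f (g [] x) * sections g x :=
  funext fun _ => rfl

lemma act_one : ∀ v : List (Fin p), act (1 : AutT p) v = v
  | [] => rfl
  | x :: w => congrArg (x :: ·) (act_one w)

lemma act_mul (f g : AutT p) : ∀ v : List (Fin p), act (f * g) v = act f (act g v)
  | [] => rfl
  | x :: w => by
      rw [act_cons (f * g), sections_mul, act_mul, act_cons g, act_cons f]
      rfl

lemma invAct_act (f : AutT p) : ∀ v : List (Fin p), invAct f (act f v) = v
  | [] => rfl
  | x :: w => by
      rw [act_cons]
      show (f [])⁻¹ (f [] x) ::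
          invAct (fun v => f (((f [])⁻¹ (f [] x)) :: v)) (act (sections f x) w) = x :: w
      rw [show (f [])⁻¹ (f [] x) = x from Equiv.symm_apply_apply (f []) x]
      exact congrArg (x :: ·) (invAct_act (sections f x) w)

instance : Group (AutT p) where
  mul_assoc f g h := by
    funext v
    show (f * g) (act h v) * h v = f (act (g * h) v) * (g * h) v
    rw [mul_apply, mul_apply, act_mul, mul_assoc]
  one_mul f := by
    funext v
    show (1 : AutT p) (act f v) * f v = f v
    rw [one_apply, one_mul]
  mul_one f := by
    funext v
    show f (act (1 : AutT p) v) * (1 : AutT p) v = f v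
    rw [act_one, one_apply, mul_one]
  inv_mul_cancel f := by
    funext v
    show f⁻¹ (act f v) * f v = (1 : AutT p) v
    rw [inv_apply, invAct_act, one_apply, inv_mul_cancel]

lemma act_length (f : AutT p) : ∀ v : List (Fin p), (act f v).length = v.length
  | [] => rfl
  | _ :: w => congrArg Nat.succ (act_length _ w)

lemma act_act_inv (f : AutT p) (v : List (Fin p)) : act f (act f⁻¹ v) = v := by
  rw [← act_mul, mul_inv_cancel, act_one]

/-- The pointwise stabilizer `st(n)` of the `n`-th level of the tree. -/
def levelStab (p n : ℕ) : Subgroup (AutT p) where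
  carrier := {f | ∀ v : List (Fin p), v.length = n → act f v = v}
  one_mem' := fun v _ => act_one v
  mul_mem' := by
    intro f g hf hg v hv
    rw [act_mul, hg v hv, hf v hv]
  inv_mem' := by
    intro f hf v hv
    have h1 : act f (act f⁻¹ v) = v := act_act_inv f v
    have h2 : act f (act f⁻¹ v) = act f⁻¹ v := hf _ (by rw [act_length, hv])
    exact h2.symm.trans h1

instance levelStab_normal (p n : ℕ) : (levelStab p n).Normal := by
  constructor
  intro f hf g v hv
  show act (g * f * g⁻¹) v = v
  rw [act_mul, act_mul, hf _ (by rw [act_length, hv]), act_act_inv]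

/-- The tuple of sections at the level-two vertices.  Restricted to the
second-level stabilizer this is the map `ψ₂`. -/
def sections2 (f : AutT p) : Fin p → Fin p → AutT p := fun x y v => f (x :: y :: v)

/-- The rooted automorphism defined by a permutation `σ` of `Fin p`. -/
def rooted (σ : Equiv.Perm (Fin p)) : AutT p := fun v => if v = [] then σ else 1

/-- The rooted automorphism `a`, acting at the root by the cycle `(1 2 … p)`. -/
def rootedA (p : ℕ) : AutT p := rooted (finRotate p)

/-- Auxiliary portrait for the directed automorphism `b_e`. -/
def directedAux (e : Fin (p - 1) → ZMod p) : List (Fin p) → Equiv.Perm (Fin p)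
  | [] => 1
  | x :: w =>
      if h : (x : ℕ) < p - 1 then
        (if w = [] then finRotate p ^ ((e ⟨x, h⟩).val) else 1)
      else directedAux e w

/-- The directed automorphism `b_e` defined by the vector `e ∈ 𝔽_p^{p-1}`,
i.e. the unique automorphism with `ψ(b_e) = (a^{e_1}, …, a^{e_{p-1}}, b_e)`. -/
def directed (e : Fin (p - 1) → ZMod p) : AutT p := directedAux e

/-- The multi-GGS-group determined by the vectors `e 1, …, e r`. -/
def multiGGS (p : ℕ) {r : ℕ} (e : Fin r → Fin (p - 1) → ZMod p) : Subgroup (AutT p) :=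
  Subgroup.closure ({rootedA p} ∪ Set.range fun i => directed (e i))

/-- The GGS-group `𝒢` defined by the (nonzero) constant vector `(c, …, c)`. -/
def constGGS (p : ℕ) (c : ZMod p) : Subgroup (AutT p) :=
  Subgroup.closure {rootedA p, directed (fun _ => c)}

/-- `G` is the GGS-group `𝒢` defined by a constant vector. -/
def IsConstGGS {p : ℕ} (G : Subgroup (AutT p)) : Prop :=
  ∃ c : ZMod p, c ≠ 0 ∧ G = constGGS p c

/-- The stabilizer `st_G(n) = G ∩ st(n)`, viewed as a subgroup of `G`. -/
def stabIn {p : ℕ} (G : Subgroup (AutT p)) (n : ℕ) : Subgroup G :=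
  (levelStab p n).comap G.subtype

instance {p : ℕ} (G : Subgroup (AutT p)) (n : ℕ) : (stabIn G n).Normal :=
  Subgroup.Normal.comap (levelStab_normal p n) G.subtype

/-- The congruence subgroup property: every finite-index subgroup of `G`
contains a level stabilizer `st_G(n)`. -/
def HasCSP {p : ℕ} (G : Subgroup (AutT p)) : Prop :=
  ∀ H : Subgroup G, H.FiniteIndex → ∃ n : ℕ, stabIn G n ≤ H

/-- `G` is just infinite: it is infinite and all its nontrivial normal
subgroups have finite index. -/
def JustInfinite {p : ℕ} (G : Subgroup (AutT p)) : Prop :=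
  Infinite G ∧ ∀ N : Subgroup G, N.Normal → N ≠ ⊥ → N.FiniteIndex

end AutT

end TreeAut

open TreeAut AutT Subgroup

namespace TreeAut

namespace AutT

variable {p : ℕ}

lemma perm_inv_apply_self {α : Type*} (σ : Equiv.Perm α) (x : α) : σ⁻¹ (σ x) = x :=
  σ.symm_apply_apply x

lemma perm_apply_inv_self {α : Type*} (σ : Equiv.Perm α) (x : α) : σ (σ⁻¹ x) = x :=
  σ.apply_symm_apply x

lemma ext_sections {f g : AutT p} (h0 : f [] = g []) (h : ∀ x, sections f x = sections g x) :
    f = g := by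
  funext v
  cases v with
  | nil => exact h0
  | cons x w => exact congrFun (h x) w

lemma root_one : (1 : AutT p) [] = 1 := rfl

lemma root_mul (f g : AutT p) : (f * g) [] = f [] * g [] := rfl

lemma root_inv (f : AutT p) : f⁻¹ [] = (f [])⁻¹ := rfl

lemma sections_one (x : Fin p) : sections (1 : AutT p) x = 1 := rfl

lemma sections_inv_root (f : AutT p) (x : Fin p) :
    sections f⁻¹ (f [] x) = (sections f x)⁻¹ := by
  rw [eq_inv_iff_mul_eq_one, ← sections_mul, inv_mul_cancel, sections_one]

lemma sections_inv (f : AutT p) (x : Fin p) :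
    sections f⁻¹ x = (sections f ((f [])⁻¹ x))⁻¹ := by
  rw [← sections_inv_root, perm_apply_inv_self]

/-- The automorphism with section `g` at the level-one vertex `x`, trivial elsewhere. -/
def atVertexFun (x : Fin p) (g : AutT p) : AutT p
  | [] => 1
  | y :: w => if y = x then g w else 1

lemma sections_atVertexFun (x y : Fin p) (g : AutT p) :
    sections (atVertexFun x g) y = if y = x then g else 1 := by
  funext w
  change (if y = x then g w else 1) = _
  split_ifs <;> rfl

/-- The embedding of `AutT p` as the automorphisms supported on the subtree at the
level-one vertex `x`. -/
def atVertex (x : Fin p) : AutT p →* AutT p :=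
  MonoidHom.mk' (atVertexFun x) (by
    intro f g
    refine ext_sections rfl fun y => ?_
    rw [sections_mul, show atVertexFun x g [] y = y from rfl]
    simp only [sections_atVertexFun]
    split_ifs
    · rfl
    · rw [one_mul])

lemma root_atVertex (x : Fin p) (g : AutT p) : atVertex x g [] = 1 := rfl

lemma sections_atVertex_self (x : Fin p) (g : AutT p) : sections (atVertex x g) x = g :=
  (sections_atVertexFun x x g).trans (if_pos rfl)

lemma sections_atVertex_of_ne {x y : Fin p} (h : y ≠ x) (g : AutT p) :
    sections (atVertex x g) y = 1 :=
  (sections_atVertexFun x y g).trans (if_neg h)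

lemma conj_atVertex (f g : AutT p) (x : Fin p) :
    f * atVertex x g * f⁻¹ = atVertex (f [] x) (sections f x * g * (sections f x)⁻¹) := by
  refine ext_sections ?_ fun y => ?_
  · simp [root_mul, root_inv, root_atVertex]
  · obtain ⟨z, rfl⟩ := (f []).surjective y
    rw [sections_mul, root_inv, perm_inv_apply_self, sections_mul, root_atVertex,
      Equiv.Perm.one_apply, sections_inv_root]
    by_cases h : z = x
    · subst h
      rw [sections_atVertex_self, sections_atVertex_self]
    · rw [sections_atVertex_of_ne h,
        sections_atVertex_of_ne (fun h' => h ((f []).injective h')), mul_one, mul_inv_cancel]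

lemma rooted_mul (σ τ : Equiv.Perm (Fin p)) : rooted (σ * τ) = rooted σ * rooted τ := by
  refine ext_sections rfl fun x => ?_
  funext w
  simp [sections, mul_apply, act_cons, rooted]

lemma rooted_one : rooted (1 : Equiv.Perm (Fin p)) = 1 := by
  funext v
  simp [rooted, one_apply]

lemma rooted_pow (σ : Equiv.Perm (Fin p)) (n : ℕ) : rooted (σ ^ n) = rooted σ ^ n := by
  induction n with
  | zero => simp [rooted_one]
  | succ n ih => rw [pow_succ, pow_succ, rooted_mul, ih]

lemma root_rooted (σ : Equiv.Perm (Fin p)) : rooted σ [] = σ := rfl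

lemma sections_rooted (σ : Equiv.Perm (Fin p)) (x : Fin p) : sections (rooted σ) x = 1 := by
  funext w
  simp [sections, rooted, one_apply]

lemma sections_conj_rooted (σ : Equiv.Perm (Fin p)) (f : AutT p) (x : Fin p) :
    sections (rooted σ * f * (rooted σ)⁻¹) x = sections f (σ⁻¹ x) := by
  rw [sections_mul, sections_mul, sections_inv, sections_rooted, sections_rooted, root_inv,
    root_rooted, inv_one, mul_one, one_mul]

lemma finRotate_pow_self (p : ℕ) : finRotate p ^ p = 1 := by
  match p with
  | 0 => rfl
  | 1 => exact Subsingleton.elim _ _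
  | n + 2 =>
    have h : orderOf (finRotate (n + 2)) = n + 2 := by
      rw [isCycle_finRotate.orderOf, support_finRotate]
      simp
    exact orderOf_dvd_iff_pow_eq_one.1 h.dvd

lemma rootedA_pow_self (p : ℕ) : rootedA p ^ p = 1 := by
  rw [rootedA, ← rooted_pow, finRotate_pow_self, rooted_one]

lemma rootedA_pow_mod (n : ℕ) : rootedA p ^ (n % p) = rootedA p ^ n := by
  conv_rhs => rw [← Nat.mod_add_div n p, pow_add, pow_mul, rootedA_pow_self, one_pow, mul_one]

lemma rootedA_pow_val_add [NeZero p] (s t : ZMod p) :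
    rootedA p ^ (s + t).val = rootedA p ^ s.val * rootedA p ^ t.val := by
  rw [ZMod.val_add, rootedA_pow_mod, pow_add]

lemma rootedA_pow_val_sub [NeZero p] (s t : ZMod p) :
    rootedA p ^ s.val * (rootedA p ^ t.val)⁻¹ = rootedA p ^ (s - t).val := by
  rw [mul_inv_eq_iff_eq_mul, ← rootedA_pow_val_add, sub_add_cancel]

/-- A subgroup containing a nontrivial power of `a` contains `a`. -/
lemma rootedA_mem_of_pow_val_mem [Fact p.Prime] (H : Subgroup (AutT p)) {s : ZMod p}
    (hs : s ≠ 0) (h : rootedA p ^ s.val ∈ H) : rootedA p ∈ H := by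
  have h1 : rootedA p ^ (s.val * s⁻¹.val) ∈ H := by
    rw [pow_mul]
    exact H.pow_mem h _
  rw [← rootedA_pow_mod, ← ZMod.val_mul, mul_inv_cancel₀ hs, ZMod.val_one, pow_one] at h1
  exact h1

lemma finRotate_pow_val (n i : ℕ) (x : Fin (n + 1)) :
    (((finRotate (n + 1)) ^ i) x : ℕ) = (x + i) % (n + 1) := by
  induction i with
  | zero => simp [Nat.mod_eq_of_lt x.isLt]
  | succ i ih =>
    rw [pow_succ', Equiv.Perm.mul_apply, finRotate_apply, Fin.val_add, ih]
    simp [← add_assoc]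

lemma exists_finRotate_pow (x y : Fin p) : ∃ i : ℕ, (finRotate p ^ i) x = y := by
  obtain _ | n := p
  · exact x.elim0
  · refine ⟨n + 1 - x + y, Fin.ext ?_⟩
    rw [finRotate_pow_val, show (x : ℕ) + (n + 1 - x + y) = y + (n + 1) by omega,
      Nat.add_mod_right, Nat.mod_eq_of_lt y.isLt]

/-- The vertex of level one at which `directed e` has section `directed e`. -/
def lastVertex (p : ℕ) [NeZero p] : Fin p := ⟨p - 1, Nat.sub_lt (NeZero.pos p) one_pos⟩

/-- The level-one vertices other than `lastVertex p`. -/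
def vertex (k : Fin (p - 1)) : Fin p := ⟨k, k.isLt.trans_le (Nat.sub_le _ _)⟩

lemma eq_lastVertex_or_vertex [NeZero p] (x : Fin p) :
    x = lastVertex p ∨ ∃ k, x = vertex k := by
  by_cases h : (x : ℕ) < p - 1
  · exact Or.inr ⟨⟨x, h⟩, rfl⟩
  · refine Or.inl (Fin.ext ?_)
    change (x : ℕ) = p - 1
    omega

lemma exists_finRotate_pow_rev [NeZero p] (k : Fin (p - 1)) : ∃ i : ℕ,
    (finRotate p ^ i) (lastVertex p) = vertex k ∧
      (finRotate p ^ i) (vertex k.rev) = lastVertex p := by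
  obtain _ | n := p
  · exact k.elim0
  · have hk : (k : ℕ) < n := k.isLt
    refine ⟨k + 1, Fin.ext ?_, Fin.ext ?_⟩
    · rw [finRotate_pow_val]
      change (n + (k + 1)) % (n + 1) = k
      rw [show n + ((k : ℕ) + 1) = k + (n + 1) by omega, Nat.add_mod_right,
        Nat.mod_eq_of_lt (by omega)]
    · rw [finRotate_pow_val]
      change ((k.rev : ℕ) + (k + 1)) % (n + 1) = n
      rw [Fin.val_rev, Nat.mod_eq_of_lt (by omega)]
      omega

lemma finRotate_vertex [NeZero p] {k l : Fin (p - 1)} (h : (l : ℕ) = k + 1) :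
    finRotate p (vertex k) = vertex l := by
  obtain _ | n := p
  · exact k.elim0
  · have hl : (l : ℕ) < n := l.isLt
    refine Fin.ext ?_
    have := finRotate_pow_val n 1 (vertex k)
    rw [pow_one] at this
    rw [this]
    change ((k : ℕ) + 1) % (n + 1) = l
    rw [h, Nat.mod_eq_of_lt (by omega)]

lemma root_directed (b : Fin (p - 1) → ZMod p) : directed b [] = 1 := rfl

lemma sections_directed_last [NeZero p] (b : Fin (p - 1) → ZMod p) :
    sections (directed b) (lastVertex p) = directed b := by
  funext w
  simp [sections, directed, directedAux, lastVertex]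

lemma sections_directed_vertex (b : Fin (p - 1) → ZMod p) (k : Fin (p - 1)) :
    sections (directed b) (vertex k) = rootedA p ^ (b k).val := by
  rw [rootedA, ← rooted_pow]
  funext w
  simp [sections, directed, directedAux, vertex, rooted]

lemma directed_add [NeZero p] (b c : Fin (p - 1) → ZMod p) :
    directed (b + c) = directed b * directed c := by
  funext v
  induction v with
  | nil => simp [root_mul, root_directed]
  | cons x w ih =>
    change sections (directed (b + c)) x w = sections (directed b * directed c) x w
    rw [sections_mul, root_directed, Equiv.Perm.one_apply]
    obtain rfl | ⟨k, rfl⟩ := eq_lastVertex_or_vertex x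
    · simp only [sections_directed_last]
      exact ih
    · simp only [sections_directed_vertex, Pi.add_apply, rootedA_pow_val_add]

lemma directed_zero [NeZero p] : directed (0 : Fin (p - 1) → ZMod p) = 1 := by
  have h := directed_add (0 : Fin (p - 1) → ZMod p) 0
  rwa [add_zero, left_eq_mul] at h

lemma directed_nsmul [NeZero p] (n : ℕ) (b : Fin (p - 1) → ZMod p) :
    directed (n • b) = directed b ^ n := by
  induction n with
  | zero => rw [zero_nsmul, pow_zero, directed_zero]
  | succ n ih => rw [succ_nsmul, pow_succ, directed_add, ih]

lemma directed_smul [NeZero p] (c : ZMod p) (b : Fin (p - 1) → ZMod p) :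
    directed (c • b) = directed b ^ c.val := by
  rw [← directed_nsmul]
  congr 1
  ext k
  simp

lemma directed_commute [NeZero p] (b c : Fin (p - 1) → ZMod p) :
    directed b * directed c = directed c * directed b := by
  rw [← directed_add, ← directed_add, add_comm]

/-- The vectors whose directed automorphism lies in a given subgroup. -/
def directedSubmodule [NeZero p] (H : Subgroup (AutT p)) :
    Submodule (ZMod p) (Fin (p - 1) → ZMod p) where
  carrier := {b | directed b ∈ H}
  zero_mem' := by
    change directed 0 ∈ H
    rw [directed_zero]
    exact H.one_mem
  add_mem' := by
    intro b c hb hc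
    change directed (b + c) ∈ H
    rw [directed_add]
    exact H.mul_mem hb hc
  smul_mem' := by
    intro c b hb
    change directed (c • b) ∈ H
    rw [directed_smul]
    exact H.pow_mem hb _

/-- The sections at `x` of the elements of `D` that fix the first level. -/
def sectionImage (D : Subgroup (AutT p)) (x : Fin p) : Subgroup (AutT p) where
  carrier := {h | ∃ f ∈ D, f [] = 1 ∧ sections f x = h}
  one_mem' := ⟨1, D.one_mem, rfl, rfl⟩
  mul_mem' := by
    rintro _ _ ⟨f, hf, hf1, rfl⟩ ⟨g, hg, hg1, rfl⟩
    exact ⟨f * g, D.mul_mem hf hg, by rw [root_mul, hf1, hg1, one_mul],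
      by rw [sections_mul, hg1, Equiv.Perm.one_apply]⟩
  inv_mem' := by
    rintro _ ⟨f, hf, hf1, rfl⟩
    exact ⟨f⁻¹, D.inv_mem hf, by rw [root_inv, hf1, inv_one],
      by rw [sections_inv, hf1, inv_one, Equiv.Perm.one_apply]⟩

end AutT

end TreeAut

section Groups

open scoped commutatorElement

variable {Γ : Type*} [Group Γ]

/-- The elements of `G` commuting with `t` modulo `K`, where `G` normalizes `K`. -/
def Subgroup.centralizerMod (G K : Subgroup Γ) (hK : ∀ g ∈ G, ∀ k ∈ K, g * k * g⁻¹ ∈ K) (t : Γ) :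
    Subgroup Γ where
  carrier := {g | g ∈ G ∧ ⁅g, t⁆ ∈ K}
  one_mem' := ⟨G.one_mem, by rw [commutatorElement_one_left]; exact K.one_mem⟩
  mul_mem' := by
    rintro g h ⟨hg, hg'⟩ ⟨hh, hh'⟩
    refine ⟨G.mul_mem hg hh, ?_⟩
    rw [show ⁅g * h, t⁆ = g * ⁅h, t⁆ * g⁻¹ * ⁅g, t⁆ by simp only [commutatorElement_def]; group]
    exact K.mul_mem (hK g hg _ hh') hg'
  inv_mem' := by
    rintro g ⟨hg, hg'⟩
    refine ⟨G.inv_mem hg, ?_⟩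
    rw [show ⁅g⁻¹, t⁆ = g⁻¹ * ⁅g, t⁆⁻¹ * g⁻¹⁻¹ by simp only [commutatorElement_def]; group]
    exact hK _ (G.inv_mem hg) _ (K.inv_mem hg')

lemma Subgroup.mem_centralizerMod_comm {G K : Subgroup Γ}
    {hK : ∀ g ∈ G, ∀ k ∈ K, g * k * g⁻¹ ∈ K} {g t : Γ} (ht : t ∈ G)
    (h : g ∈ G.centralizerMod K hK t) : t ∈ G.centralizerMod K hK g :=
  ⟨ht, by rw [← commutatorElement_inv]; exact K.inv_mem h.2⟩

/-- If the generators of `G` commute modulo `K`, then `K` contains the derived subgroup. -/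
lemma Subgroup.commutator_closure_le {S : Set Γ} {K : Subgroup Γ}
    (hK : ∀ g ∈ closure S, ∀ k ∈ K, g * k * g⁻¹ ∈ K) (h : ∀ s ∈ S, ∀ t ∈ S, ⁅s, t⁆ ∈ K) :
    ⁅closure S, closure S⁆ ≤ K := by
  have key : ∀ t ∈ S, closure S ≤ (closure S).centralizerMod K hK t := fun t ht =>
    (closure_le _).2 fun s hs => ⟨subset_closure hs, h s hs t ht⟩
  rw [commutator_le]
  intro g hg t ht
  have : closure S ≤ (closure S).centralizerMod K hK g :=
    (closure_le _).2 fun s hs => mem_centralizerMod_comm (subset_closure hs) (key s hs hg)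
  exact (mem_centralizerMod_comm hg (this ht)).2

lemma Subgroup.conj_mem_commutator {G H₁ H₂ : Subgroup Γ}
    (h₁ : ∀ g ∈ G, ∀ h ∈ H₁, g * h * g⁻¹ ∈ H₁) (h₂ : ∀ g ∈ G, ∀ h ∈ H₂, g * h * g⁻¹ ∈ H₂) :
    ∀ g ∈ G, ∀ h ∈ ⁅H₁, H₂⁆, g * h * g⁻¹ ∈ ⁅H₁, H₂⁆ := by
  intro g hg
  suffices ⁅H₁, H₂⁆ ≤ ⁅H₁, H₂⁆.comap (MulAut.conj g).toMonoidHom from fun h hh => this hh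
  rw [commutator_le]
  intro x hx y hy
  change g * ⁅x, y⁆ * g⁻¹ ∈ ⁅H₁, H₂⁆
  rw [show g * ⁅x, y⁆ * g⁻¹ = ⁅g * x * g⁻¹, g * y * g⁻¹⁆ by
    simp only [commutatorElement_def]; group]
  exact commutator_mem_commutator (h₁ g hg x hx) (h₂ g hg y hy)

end Groups

section LinearAlgebra

variable {F ι : Type*} [Field F]

/-- If the coordinate hyperplanes of `V` (for nonvanishing coordinates) lie in `W` and `V` has
dimension at least two, then `V ≤ W`. -/
lemma Submodule.le_of_coordinate_hyperplanes (V W : Submodule F (ι → F))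
    {u v : ι → F} (hu : u ∈ V) (hv : v ∈ V) (huv : LinearIndependent F ![u, v])
    (τ : ι → ι) (hτ : Function.Involutive τ)
    (h : ∀ k, (∃ c ∈ V, c (τ k) ≠ 0) → ∀ b ∈ V, b k = 0 → b ∈ W) : V ≤ W := by
  intro b hb
  by_contra hbW
  have hk : ∀ k, (∃ c ∈ V, c (τ k) ≠ 0) → b k ≠ 0 := fun k hc h0 => hbW (h k hc b hb h0)
  have hmul : ∀ c ∈ V, ∃ t : F, c = t • b := by
    intro c hc
    have hsub : ∀ k, b k ≠ 0 → c - (c k / b k) • b ∈ W := by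
      intro k hbk
      have h1 : b (τ k) ≠ 0 := hk (τ k) ⟨b, hb, by rwa [hτ k]⟩
      refine h k ⟨b, hb, h1⟩ _ (V.sub_mem hc (V.smul_mem _ hb)) ?_
      simp [hbk]
    have hb0 : b ≠ 0 := fun h0 => hbW (h0 ▸ W.zero_mem)
    obtain ⟨l, hl⟩ := Function.ne_iff.1 hb0
    refine ⟨c l / b l, funext fun k => ?_⟩
    by_cases hbk : b k = 0
    · have hck : c k = 0 := by
        by_contra hck
        have h1 : b (τ k) ≠ 0 := hk (τ k) ⟨c, hc, by rwa [hτ k]⟩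
        exact hk k ⟨b, hb, h1⟩ hbk
      simp [hck, hbk]
    · have hmem := W.sub_mem (hsub k hbk) (hsub l hl)
      rw [sub_sub_sub_cancel_left, ← sub_smul] at hmem
      have h0 : c l / b l - c k / b k = 0 := by
        by_contra hne
        exact hbW ((W.smul_mem_iff hne).1 hmem)
      rw [sub_eq_zero] at h0
      simp [h0, hbk]
  obtain ⟨s, hs⟩ := hmul u hu
  obtain ⟨t, ht⟩ := hmul v hv
  have h1 := (LinearIndependent.pair_iff.1 huv) t (-s) (by
    rw [hs, ht, smul_smul, smul_smul, ← add_smul]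
    simp [mul_comm])
  have hs0 : s = 0 := by simpa using h1.2
  have h2 := (LinearIndependent.pair_iff.1 huv) 1 0 (by rw [hs, hs0]; simp)
  exact one_ne_zero h2.1

/-- One of two linearly independent vectors is not constant. -/
lemma exists_succ_ne_of_linearIndependent {n : ℕ} {u v : Fin n → F}
    (huv : LinearIndependent F ![u, v]) :
    ∃ w ∈ ({u, v} : Set (Fin n → F)), ∃ k l : Fin n, (l : ℕ) = k + 1 ∧ w k ≠ w l := by
  by_contra! hcon
  obtain _ | n := n
  · have h := (LinearIndependent.pair_iff.1 huv) 1 0 (Subsingleton.elim _ _)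
    exact one_ne_zero h.1
  have hconst : ∀ w ∈ ({u, v} : Set (Fin (n + 1) → F)), ∀ k, w k = w 0 := by
    intro w hw k
    induction k using Fin.induction with
    | zero => rfl
    | succ k ih => rw [← ih, hcon w hw k.castSucc k.succ (by simp)]
  have hu := hconst u (by simp)
  have hv := hconst v (by simp)
  have h1 := (LinearIndependent.pair_iff.1 huv) (v 0) (-u 0) (by
    ext k
    simp [hu k, hv k, mul_comm])
  have h2 := (LinearIndependent.pair_iff.1 huv) 1 0 (by
    ext k
    have : u 0 = 0 := by simpa using h1.2
    simp [hu k, this])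
  exact one_ne_zero h2.1

end LinearAlgebra

namespace TreeAut

namespace AutT

open scoped commutatorElement

variable {p r : ℕ} {e : Fin r → Fin (p - 1) → ZMod p}

lemma rootedA_mem_multiGGS : rootedA p ∈ multiGGS p e := subset_closure (Or.inl rfl)

lemma rooted_finRotate_pow_mem_multiGGS (i : ℕ) : rooted (finRotate p ^ i) ∈ multiGGS p e := by
  rw [rooted_pow]
  exact pow_mem rootedA_mem_multiGGS i

lemma directed_mem_multiGGS (i : Fin r) : directed (e i) ∈ multiGGS p e :=
  subset_closure (Or.inr ⟨i, rfl⟩)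

lemma directed_mem_multiGGS_of_mem_span [NeZero p] {b : Fin (p - 1) → ZMod p}
    (hb : b ∈ Submodule.span (ZMod p) (Set.range e)) : directed b ∈ multiGGS p e := by
  have h : Submodule.span (ZMod p) (Set.range e) ≤ directedSubmodule (multiGGS p e) := by
    rw [Submodule.span_le]
    rintro _ ⟨i, rfl⟩
    exact directed_mem_multiGGS i
  exact h hb

lemma conj_mem_self {Γ : Type*} [Group Γ] (G : Subgroup Γ) :
    ∀ g ∈ G, ∀ h ∈ G, g * h * g⁻¹ ∈ G :=
  fun _ hg _ hh => G.mul_mem (G.mul_mem hg hh) (G.inv_mem hg)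

lemma conj_mem_derived {Γ : Type*} [Group Γ] (G : Subgroup Γ) :
    ∀ g ∈ G, ∀ h ∈ ⁅G, G⁆, g * h * g⁻¹ ∈ ⁅G, G⁆ :=
  conj_mem_commutator (conj_mem_self G) (conj_mem_self G)

/-- If `D` is normalized by `a`, its sections at all level-one vertices agree. -/
lemma sectionImage_le (D : Subgroup (AutT p))
    (hD : ∀ g ∈ multiGGS p e, ∀ h ∈ D, g * h * g⁻¹ ∈ D) (x y : Fin p) :
    sectionImage D x ≤ sectionImage D y := by
  rintro _ ⟨f, hf, hf1, rfl⟩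
  obtain ⟨i, hi⟩ := exists_finRotate_pow x y
  refine ⟨_, hD _ (rooted_finRotate_pow_mem_multiGGS i) f hf, ?_, ?_⟩
  · simp [root_mul, root_inv, hf1]
  · rw [sections_conj_rooted, ← hi, perm_inv_apply_self]

/-- If `D` is normalized by `a`, membership of `atVertex x g` in `D` does not depend on `x`. -/
lemma atVertex_mem (D : Subgroup (AutT p))
    (hD : ∀ g ∈ multiGGS p e, ∀ h ∈ D, g * h * g⁻¹ ∈ D) {x : Fin p} (y : Fin p) {g : AutT p}
    (h : atVertex x g ∈ D) : atVertex y g ∈ D := by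
  obtain ⟨i, hi⟩ := exists_finRotate_pow x y
  have := hD _ (rooted_finRotate_pow_mem_multiGGS i) _ h
  rwa [conj_atVertex, sections_rooted, root_rooted, hi, one_mul, inv_one, mul_one] at this

lemma root_commutator (f g : AutT p) (h : f [] = 1) : ⁅f, g⁆ [] = 1 := by
  simp [commutatorElement_def, root_mul, root_inv, h]

lemma sections_commutator_conj (b c : AutT p) (σ : Equiv.Perm (Fin p)) (hb : b [] = 1)
    (hc : c [] = 1) (x : Fin p) :
    sections ⁅b, rooted σ * c * (rooted σ)⁻¹⁆ x = ⁅sections b x, sections c (σ⁻¹ x)⁆ := by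
  rw [← sections_conj_rooted]
  have h : (rooted σ * c * (rooted σ)⁻¹) [] = 1 := by simp [root_mul, root_inv, hc]
  simp only [commutatorElement_def, sections_mul, sections_inv b, root_inv, hb,
    sections_inv (rooted σ * c * (rooted σ)⁻¹), h, inv_one, Equiv.Perm.one_apply]

lemma sections_commutator_rootedA (b : AutT p) (hb : b [] = 1) (x : Fin p) :
    sections ⁅b, rootedA p⁆ (finRotate p x) =
      sections b (finRotate p x) * (sections b x)⁻¹ := by
  have h : ⁅b, rootedA p⁆ = b * (rootedA p * b * (rootedA p)⁻¹)⁻¹ := by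
    simp only [commutatorElement_def]; group
  have h1 : (rootedA p * b * (rootedA p)⁻¹) [] = 1 := by simp [root_mul, root_inv, hb]
  rw [h, sections_mul, sections_inv, root_inv, h1, inv_one, Equiv.Perm.one_apply, rootedA,
    sections_conj_rooted, perm_inv_apply_self]

/-- The sections at any level-one vertex of the derived subgroup cover the whole group. -/
lemma multiGGS_le_sectionImage [Fact p.Prime] (hp3 : 3 ≤ p)
    (hne : ∃ j, ∃ k l : Fin (p - 1), (l : ℕ) = k + 1 ∧ e j k ≠ e j l) (x : Fin p) :
    multiGGS p e ≤ sectionImage ⁅multiGGS p e, multiGGS p e⁆ x := by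
  have hD := conj_mem_derived (multiGGS p e)
  have hcomm : ∀ i, ∀ y, sections (directed (e i)) (finRotate p y) *
      (sections (directed (e i)) y)⁻¹ ∈ sectionImage ⁅multiGGS p e, multiGGS p e⁆ x := by
    intro i y
    refine sectionImage_le _ hD (finRotate p y) x ⟨_, commutator_mem_commutator
      (directed_mem_multiGGS i) rootedA_mem_multiGGS, root_commutator _ _ (root_directed _), ?_⟩
    rw [sections_commutator_rootedA _ (root_directed _)]
  have ha : rootedA p ∈ sectionImage ⁅multiGGS p e, multiGGS p e⁆ x := by
    obtain ⟨j, k, l, hkl, hjkl⟩ := hne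
    have h := hcomm j (vertex k)
    rw [finRotate_vertex hkl, sections_directed_vertex, sections_directed_vertex,
      rootedA_pow_val_sub] at h
    exact rootedA_mem_of_pow_val_mem _ (sub_ne_zero.2 hjkl.symm) h
  refine (closure_le _).2 ?_
  rintro _ (rfl | ⟨i, rfl⟩)
  · exact ha
  · obtain ⟨y, hy⟩ := (finRotate p).surjective (lastVertex p)
    have h := hcomm i y
    rw [hy, sections_directed_last] at h
    obtain rfl | ⟨k, rfl⟩ := eq_lastVertex_or_vertex y
    · exfalso
      obtain _ | n := p
      · omega
      · have := congrArg Fin.val hy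
        rw [← pow_one (finRotate (n + 1)), finRotate_pow_val] at this
        change (n + 1) % (n + 1) = n at this
        rw [Nat.mod_self] at this
        omega
    · rw [sections_directed_vertex] at h
      exact ((sectionImage _ x).mul_mem_cancel_right
        ((sectionImage _ x).inv_mem ((sectionImage _ x).pow_mem ha _))).1 h

/-- The elements whose embedding at `x` lies in `D` form a subgroup normalized by `G`. -/
lemma conj_mem_comap_atVertex {G D : Subgroup (AutT p)} (x : Fin p)
    (hG : G ≤ sectionImage G x) (hD : ∀ g ∈ G, ∀ h ∈ D, g * h * g⁻¹ ∈ D) :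
    ∀ g ∈ G, ∀ h ∈ D.comap (atVertex x), g * h * g⁻¹ ∈ D.comap (atVertex x) := by
  intro g hg h hh
  obtain ⟨f, hf, hf1, rfl⟩ := hG hg
  have := hD f hf _ hh
  rwa [conj_atVertex, hf1, Equiv.Perm.one_apply] at this

lemma sectionImage_mono {D₁ D₂ : Subgroup (AutT p)} (h : D₁ ≤ D₂) (x : Fin p) :
    sectionImage D₁ x ≤ sectionImage D₂ x := by
  rintro _ ⟨f, hf, hf1, rfl⟩
  exact ⟨f, h hf, hf1, rfl⟩

lemma derived_le {Γ : Type*} [Group Γ] (G : Subgroup Γ) : ⁅G, G⁆ ≤ G :=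
  commutator_le.2 fun _ hg _ hh =>
    G.mul_mem (G.mul_mem (G.mul_mem hg hh) (G.inv_mem hg)) (G.inv_mem hh)

/-- The commutator of `b` with a conjugate of `c` lies in the third term of the lower central
series whenever `b` and `c` commute. -/
lemma commutator_conj_mem {Γ : Type*} [Group Γ] {G : Subgroup Γ} {b c s : Γ} (hb : b ∈ G)
    (hc : c ∈ G) (hs : s ∈ G) (hbc : b * c = c * b) :
    ⁅b, s * c * s⁻¹⁆ ∈ ⁅⁅G, G⁆, G⁆ := by
  have h : ⁅b, s * c * s⁻¹⁆ = ⁅⁅b, s⁆, s * c * s⁻¹⁆ := by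
    have h' : b⁻¹ * c * b = c := by rw [mul_assoc, ← hbc, inv_mul_cancel_left]
    calc ⁅b, s * c * s⁻¹⁆ = b * s * c * s⁻¹ * b⁻¹ * (s * c * s⁻¹)⁻¹ := by
          simp only [commutatorElement_def]; group
      _ = b * s * (b⁻¹ * c * b) * s⁻¹ * b⁻¹ * (s * c * s⁻¹)⁻¹ := by rw [h']
      _ = _ := by simp only [commutatorElement_def]; group
  rw [h]
  exact commutator_mem_commutator (commutator_mem_commutator hb hs)
    (G.mul_mem (G.mul_mem hs hc) (G.inv_mem hs))

/-- `ψ(γ₃(G))` contains `G' × ⋯ × G'`. -/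
lemma atVertex_mem_gamma_three [Fact p.Prime]
    (hfr : ∀ x, multiGGS p e ≤ sectionImage (multiGGS p e) x) {i j : Fin r}
    (hij : LinearIndependent (ZMod p) ![e i, e j]) (x : Fin p) :
    ∀ g ∈ ⁅multiGGS p e, multiGGS p e⁆,
      atVertex x g ∈ ⁅⁅multiGGS p e, multiGGS p e⁆, multiGGS p e⁆ := by
  have hN := conj_mem_commutator (conj_mem_derived (multiGGS p e)) (conj_mem_self (multiGGS p e))
  have hK := conj_mem_comap_atVertex (lastVertex p) (hfr _) hN
  suffices h : ⁅multiGGS p e, multiGGS p e⁆ ≤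
      (⁅⁅multiGGS p e, multiGGS p e⁆, multiGGS p e⁆).comap (atVertex (lastVertex p)) from
    fun g hg => atVertex_mem _ hN x (h hg)
  have hV : Submodule.span (ZMod p) (Set.range e) ≤
      directedSubmodule ((multiGGS p e).centralizerMod _ hK (rootedA p)) := by
    refine Submodule.le_of_coordinate_hyperplanes _ _ (Submodule.subset_span ⟨i, rfl⟩)
      (Submodule.subset_span ⟨j, rfl⟩) hij Fin.rev Fin.rev_involutive ?_
    rintro k ⟨c, hc, hck⟩ b hb hbk
    have hbG := directed_mem_multiGGS_of_mem_span hb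
    have hcG := directed_mem_multiGGS_of_mem_span hc
    obtain ⟨n, hn1, hn2⟩ := exists_finRotate_pow_rev k
    have hn1' : (finRotate p ^ n)⁻¹ (vertex k) = lastVertex p := by
      rw [← hn1, perm_inv_apply_self]
    have hn2' : (finRotate p ^ n)⁻¹ (lastVertex p) = vertex k.rev := by
      rw [← hn2, perm_inv_apply_self]
    have hmem := commutator_conj_mem hbG hcG
      (rooted_finRotate_pow_mem_multiGGS (e := e) n) (directed_commute b c)
    have heq : ⁅directed b,
        rooted (finRotate p ^ n) * directed c * (rooted (finRotate p ^ n))⁻¹⁆ =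
        atVertex (lastVertex p) ⁅directed b, rootedA p ^ (c k.rev).val⁆ := by
      refine ext_sections (root_commutator _ _ (root_directed b)) fun y => ?_
      rw [sections_commutator_conj _ _ _ (root_directed b) (root_directed c)]
      obtain rfl | ⟨l, rfl⟩ := eq_lastVertex_or_vertex y
      · rw [sections_atVertex_self, sections_directed_last, hn2', sections_directed_vertex]
      · rw [sections_atVertex_of_ne (fun h => l.isLt.ne (congrArg Fin.val h)),
          sections_directed_vertex]
        by_cases hlk : l = k
        · rw [hlk, hbk, ZMod.val_zero, pow_zero, commutatorElement_one_left]
        · obtain hz | ⟨m, hm⟩ := eq_lastVertex_or_vertex ((finRotate p ^ n)⁻¹ (vertex l))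
          · rw [← hn1'] at hz
            have hlk' := congrArg Fin.val ((finRotate p ^ n)⁻¹.injective hz)
            exact (hlk (Fin.ext hlk')).elim
          · rw [hm, sections_directed_vertex, commutatorElement_eq_one_iff_mul_comm, ← pow_add,
              ← pow_add, add_comm]
    rw [heq] at hmem
    have hpow : rootedA p ^ (c k.rev).val ∈ (multiGGS p e).centralizerMod _ hK (directed b) :=
      mem_centralizerMod_comm (pow_mem rootedA_mem_multiGGS _) ⟨hbG, hmem⟩
    exact mem_centralizerMod_comm hbG (rootedA_mem_of_pow_val_mem _ hck hpow)
  have hea : ∀ i, directed (e i) ∈ (multiGGS p e).centralizerMod _ hK (rootedA p) :=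
    fun i => hV (Submodule.subset_span ⟨i, rfl⟩)
  refine commutator_closure_le hK ?_
  rintro _ (rfl | ⟨i, rfl⟩) _ (rfl | ⟨j, rfl⟩)
  · rw [commutatorElement_self]
    exact one_mem _
  · exact (mem_centralizerMod_comm rootedA_mem_multiGGS (hea j)).2
  · exact (hea i).2
  · rw [commutatorElement_eq_one_iff_mul_comm.2 (directed_commute _ _)]
    exact one_mem _

/-- `ψ(G'')` contains `γ₃(G) × ⋯ × γ₃(G)`, provided `ψ(G')` contains `G' × ⋯ × G'`. -/
lemma atVertex_mem_second_derived {G : Subgroup (AutT p)} (x : Fin p)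
    (hG : G ≤ sectionImage ⁅G, G⁆ x) (h : ∀ g ∈ ⁅G, G⁆, atVertex x g ∈ ⁅G, G⁆) :
    ∀ g ∈ ⁅⁅G, G⁆, G⁆, atVertex x g ∈ ⁅⁅G, G⁆, ⁅G, G⁆⁆ := by
  suffices hle : ⁅⁅G, G⁆, G⁆ ≤ (⁅⁅G, G⁆, ⁅G, G⁆⁆).comap (atVertex x) from fun g hg => hle hg
  rw [commutator_le]
  intro g hg k hk
  obtain ⟨f, hf, hf1, rfl⟩ := hG hk
  change atVertex x _ ∈ ⁅⁅G, G⁆, ⁅G, G⁆⁆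
  have heq : atVertex x ⁅g, sections f x⁆ = ⁅atVertex x g, f⁆ := by
    rw [show ⁅atVertex x g, f⁆ = atVertex x g * (f * atVertex x g⁻¹ * f⁻¹) by
      simp only [commutatorElement_def, map_inv]; group, conj_atVertex, hf1,
      Equiv.Perm.one_apply, ← map_mul]
    congr 1
    simp only [commutatorElement_def]; group
  rw [heq]
  exact commutator_mem_commutator (h g hg) hf

lemma mem_levelStab_two {f : AutT p} (h0 : f [] = 1) (h1 : ∀ x, f [x] = 1) :
    f ∈ levelStab p 2 := by
  intro v hv
  match v, hv with
  | [x, y], _ =>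
    have h1' : sections f x [] = 1 := h1 x
    rw [act_cons, act_cons, act_nil, h0, h1']
    rfl

/-- A subgroup containing all `ψ₂`-coordinate embeddings of `D` contains `D × ⋯ × D`. -/
lemma exists_sections2_eq (D E : Subgroup (AutT p))
    (h : ∀ x y, ∀ g ∈ D, atVertex x (atVertex y g) ∈ E) (g : Fin p → Fin p → AutT p)
    (hg : ∀ x y, g x y ∈ D) : ∃ f ∈ E ⊓ levelStab p 2, sections2 f = g := by
  have key : ∀ s : Finset (Fin p × Fin p), ∃ f ∈ E, f [] = 1 ∧ (∀ x, f [x] = 1) ∧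
      ∀ x y, sections (sections f x) y = if (x, y) ∈ s then g x y else 1 := by
    intro s
    induction s using Finset.induction_on with
    | empty => exact ⟨1, E.one_mem, rfl, fun _ => rfl, fun _ _ => rfl⟩
    | insert z s hz ih =>
      obtain ⟨f, hf, h0, h1, h2⟩ := ih
      obtain ⟨x₀, y₀⟩ := z
      refine ⟨atVertex x₀ (atVertex y₀ (g x₀ y₀)) * f, E.mul_mem (h _ _ _ (hg _ _)) hf, ?_, ?_, ?_⟩
      · rw [root_mul, root_atVertex, h0, one_mul]
      · intro x
        change sections (_ * f) x [] = 1
        have h1' : sections f x [] = 1 := h1 x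
        rw [sections_mul, h0, Equiv.Perm.one_apply, root_mul, h1', mul_one]
        by_cases hx : x = x₀
        · rw [hx, sections_atVertex_self, root_atVertex]
        · rw [sections_atVertex_of_ne hx, root_one]
      · intro x y
        have h1' : sections f x [] = 1 := h1 x
        rw [sections_mul, h0, Equiv.Perm.one_apply, sections_mul, h1', Equiv.Perm.one_apply, h2]
        by_cases hx : x = x₀
        · subst hx
          rw [sections_atVertex_self]
          by_cases hy : y = y₀
          · subst hy
            rw [sections_atVertex_self]
            simp [hz]
          · rw [sections_atVertex_of_ne hy]
            simp [hy]
        · rw [sections_atVertex_of_ne hx, sections_one]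
          simp [hx]
  obtain ⟨f, hf, h0, h1, h2⟩ := key Finset.univ
  refine ⟨f, ⟨hf, mem_levelStab_two h0 h1⟩, ?_⟩
  funext x y
  exact (h2 x y).trans (if_pos (Finset.mem_univ _))

end AutT

end TreeAut

/-- For a multi-GGS-group with `r ≥ 2`, `ψ₂(G'' ∩ st(2))` contains
`G' × ⋯ × G'` (`p²` factors). -/
theorem psi2_second_derived_ge
    (p r : ℕ) (hp : p.Prime) (hpodd : Odd p) (hr : 2 ≤ r)
    (e : Fin r → Fin (p - 1) → ZMod p) (he : LinearIndependent (ZMod p) e) :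
    ∀ g : Fin p → Fin p → AutT p, (∀ x y : Fin p, g x y ∈ ⁅multiGGS p e, multiGGS p e⁆) →
      ∃ f ∈ (⁅⁅multiGGS p e, multiGGS p e⁆, ⁅multiGGS p e, multiGGS p e⁆⁆ ⊓ levelStab p 2 : Subgroup (AutT p)), sections2 f = g := by
  have : Fact p.Prime := ⟨hp⟩
  have hp3 : 3 ≤ p := by
    have := hp.two_le
    obtain ⟨m, rfl⟩ := hpodd
    omega
  let i : Fin r := ⟨0, by omega⟩
  let j : Fin r := ⟨1, by omega⟩
  have hij : LinearIndependent (ZMod p) ![e i, e j] := by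
    have hinj : Function.Injective ![i, j] := by
      intro s t
      fin_cases s <;> fin_cases t <;> simp [i, j]
    have h := he.comp ![i, j] hinj
    rwa [show e ∘ ![i, j] = ![e i, e j] by ext s; fin_cases s <;> rfl] at h
  have hne : ∃ j, ∃ k l : Fin (p - 1), (l : ℕ) = k + 1 ∧ e j k ≠ e j l := by
    obtain ⟨w, rfl | rfl, k, l, h⟩ := exists_succ_ne_of_linearIndependent hij
    · exact ⟨i, k, l, h⟩
    · exact ⟨j, k, l, h⟩
  have hsec := multiGGS_le_sectionImage hp3 hne
  have hγ := atVertex_mem_gamma_three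
    (fun x => (hsec x).trans (sectionImage_mono (derived_le _) x)) hij
  have hγle : ⁅⁅multiGGS p e, multiGGS p e⁆, multiGGS p e⁆ ≤ ⁅multiGGS p e, multiGGS p e⁆ :=
    commutator_mono (derived_le _) le_rfl
  intro g hg
  exact exists_sections2_eq _ _ (fun x y k hk => atVertex_mem_second_derived x (hsec x)
    (fun k hk => hγle (hγ x k hk)) _ (hγ y k hk)) g hg
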